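/- Let G be a connected simple graph with toughness τ(G) = t ≤ 1, let S be a tough-set of G that is maximal (with respect to set inclusion) among tough-sets of G, and let R be a connected component of G − S. If k is a positive integer and t ≥ 1/k, then R is (1/k)-tough. -/

import Mathlib

open SimpleGraph

variable {V : Type*} {W : Type*}

/-- A graph is `P₄`-free if it contains no induced subgraph isomorphic to the
path on four vertices. -/
def P4Free (G : SimpleGraph V) : Prop := IsEmpty (SimpleGraph.pathGraph 4 ↪g G)

/-- `R` is (the vertex set of) a connected component of `G - S`:
a maximal subset of `V(G) - S` inducing a connected subgraph. -/
def IsCompOf (G : SimpleGraph V) (S R : Set V) : Prop :=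
  R ⊆ Sᶜ ∧ (G.induce R).Connected ∧
    ∀ R' : Set V, R ⊆ R' → R' ⊆ Sᶜ → (G.induce R').Connected → R' = R

/-- The number of connected components of `G - S`. -/
noncomputable def numComp (G : SimpleGraph V) (S : Set V) : ℕ :=
  {R : Set V | IsCompOf G S R}.ncard

/-- `S` is a cutset of `G` : the graph `G - S` is disconnected. -/
def IsCutset (G : SimpleGraph V) (S : Set V) : Prop := 2 ≤ numComp G S

/-- `G` is `t`-tough: for every cutset `S`, `t * c(G - S) ≤ |S|`. -/
def Tough (t : ℝ) (G : SimpleGraph V) : Prop :=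
  ∀ S : Set V, IsCutset G S → t * (numComp G S : ℝ) ≤ (S.ncard : ℝ)

/-- `t` is the toughness of `G` : the largest `s` such that `G` is `s`-tough.
(For a complete graph no such largest `s` exists; the toughness is infinite.) -/
def IsToughness (G : SimpleGraph V) (t : ℝ) : Prop :=
  Tough t G ∧ ∀ s : ℝ, Tough s G → s ≤ t

/-- `S` is a tough-set of `G` (whose toughness is `t`): a cutset with
`|S| = t * c(G - S)`. -/
def ToughSet (G : SimpleGraph V) (t : ℝ) (S : Set V) : Prop :=
  IsCutset G S ∧ (S.ncard : ℝ) = t * (numComp G S : ℝ)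

/-- Vertex `u` is adjacent in `G` to some vertex of the set `R`. -/
def AdjToSet (G : SimpleGraph V) (u : V) (R : Set V) : Prop := ∃ v ∈ R, G.Adj u v

/-- `G` has a Hamiltonian cycle. -/
def HasHamCycle [DecidableEq V] (G : SimpleGraph V) : Prop :=
  ∃ (v : V) (w : G.Walk v v), w.IsHamiltonianCycle

/-- `G` has a spanning `k`-walk: a closed walk visiting every vertex at least once
and at most `k` times.  (In a nontrivial closed walk the base vertex occurs one
extra time in `Walk.support`, whence the correction term.) -/
def HasSpanningKWalk [DecidableEq V] (G : SimpleGraph V) (k : ℕ) : Prop :=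
  ∃ (v : V) (w : G.Walk v v), (∀ x : V, x ∈ w.support) ∧
    ∀ x : V, w.support.count x ≤ k + (if x = v then 1 else 0)

/-- The prism over `G`: the Cartesian (box) product `G □ K₂`. -/
def prism (G : SimpleGraph V) : SimpleGraph (V × Fin 2) :=
  G.boxProd (⊤ : SimpleGraph (Fin 2))

/-- The graph obtained from `G` by contracting the set `R` to a single vertex
(namely `Sum.inr ()`), which is adjacent to exactly those vertices outside `R`
having a neighbor in `R`. -/
def contractSet (G : SimpleGraph V) (R : Set V) : SimpleGraph (↥(Rᶜ) ⊕ Unit) :=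
  SimpleGraph.fromRel fun x y =>
    match x, y with
    | Sum.inl a, Sum.inl b => G.Adj ↑a ↑b
    | Sum.inl a, Sum.inr _ => ∃ r ∈ R, G.Adj ↑a r
    | _, _ => False

/-- `v` is a cutvertex of `H` : deleting `v` leaves a disconnected
(non-preconnected) graph. -/
def IsCutvertex (H : SimpleGraph W) (v : W) : Prop :=
  ¬ (H.induce ({v}ᶜ : Set W)).Preconnected

/-- `B` is a block of `H` : a maximal connected subgraph having no cutvertex of
its own. -/
def IsBlock (H : SimpleGraph W) (B : H.Subgraph) : Prop :=
  B.coe.Connected ∧ (∀ v, ¬ IsCutvertex B.coe v) ∧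
    ∀ B' : H.Subgraph, B ≤ B' → B'.coe.Connected →
      (∀ v, ¬ IsCutvertex B'.coe v) → B' = B

/-- `H` is a cycle of even length. -/
def IsEvenCycleGraph (H : SimpleGraph W) : Prop :=
  ∃ n : ℕ, Even n ∧ 3 ≤ n ∧ Nonempty (H ≃g SimpleGraph.cycleGraph n)

/-- `H` is a single edge. -/
def IsSingleEdgeGraph (H : SimpleGraph W) : Prop :=
  ∃ u v : W, u ≠ v ∧ H.Adj u v ∧ ∀ w : W, w = u ∨ w = v

/-- `H` is a simple block EP (SBEP) graph: a connected graph in which every block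
is an even cycle or a single edge, and every vertex lies in at most two blocks. -/
def IsSBEP (H : SimpleGraph W) : Prop :=
  H.Connected ∧
    (∀ B : H.Subgraph, IsBlock H B → IsEvenCycleGraph B.coe ∨ IsSingleEdgeGraph B.coe) ∧
    ∀ (v : W) (B₁ B₂ B₃ : H.Subgraph),
      IsBlock H B₁ ∧ v ∈ B₁.verts → IsBlock H B₂ ∧ v ∈ B₂.verts →
      IsBlock H B₃ ∧ v ∈ B₃.verts → B₁ = B₂ ∨ B₁ = B₃ ∨ B₂ = B₃

/-- `v` is a single-block vertex of `H` : it lies in exactly one block. -/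
def SingleBlockVertex (H : SimpleGraph W) (v : W) : Prop :=
  ∃! B : H.Subgraph, IsBlock H B ∧ v ∈ B.verts

namespace IsCompOf

variable {G : SimpleGraph V} {S R A B : Set V}

theorem nonempty (h : IsCompOf G S R) : R.Nonempty :=
  Set.nonempty_coe_sort.1 h.2.1.nonempty

/-- A connected set avoiding `S` that meets a component of `G - S` lies inside it. -/
theorem subset_of_connected (h : IsCompOf G S R) (hA : A ⊆ Sᶜ)
    (hconn : (G.induce A).Connected) (hmeet : (R ∩ A).Nonempty) : A ⊆ R := by
  have hunion := h.2.2 (R ∪ A) Set.subset_union_left (Set.union_subset h.1 hA)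
    (SimpleGraph.induce_union_connected h.2.1.preconnected hconn.preconnected hmeet)
  exact Set.union_eq_left.1 hunion

theorem eq_of_inter_nonempty (hA : IsCompOf G S A) (hB : IsCompOf G S B)
    (hmeet : (A ∩ B).Nonempty) : A = B :=
  (hB.subset_of_connected hA.1 hA.2.1 (Set.inter_comm A B ▸ hmeet)).antisymm
    (hA.subset_of_connected hB.1 hB.2.1 hmeet)

/-- Deleting further vertices inside one component leaves the other components intact. -/
theorem union_of_ne (hA : IsCompOf G S A) (hR : IsCompOf G S R) (hne : A ≠ R)
    (X : Set R) : IsCompOf G (S ∪ Subtype.val '' X) A := by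
  refine ⟨fun a ha hmem => ?_, hA.2.1, fun R' hR' hsub hconn =>
    hA.2.2 R' hR' (fun x hx hxS => hsub hx (Or.inl hxS)) hconn⟩
  rcases hmem with hmem | ⟨x, -, rfl⟩
  · exact hA.1 ha hmem
  · exact hne (hA.eq_of_inter_nonempty hR ⟨x, ha, x.2⟩)

end IsCompOf

theorem induce_induce_connected_iff (G : SimpleGraph V) (R : Set V) (B : Set R) :
    ((G.induce R).induce B).Connected ↔ (G.induce (Subtype.val '' B)).Connected := by
  refine SimpleGraph.Iso.connected_iff
    ⟨Equiv.Set.image Subtype.val B Subtype.val_injective, ?_⟩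
  rintro ⟨a, ha⟩ ⟨b, hb⟩
  simp [Equiv.Set.image, Equiv.Set.imageOfInjOn]

/-- Components of `R - X` are components of `G - (S ∪ X)` when `R` is a component of `G - S`. -/
theorem IsCompOf.image_val {G : SimpleGraph V} {S R : Set V} (hR : IsCompOf G S R)
    {X B : Set R} (hB : IsCompOf (G.induce R) X B) :
    IsCompOf G (S ∪ Subtype.val '' X) (Subtype.val '' B) := by
  refine ⟨?_, (induce_induce_connected_iff G R B).1 hB.2.1, fun R' hsub hR' hconn => ?_⟩
  · rintro _ ⟨b, hb, rfl⟩ (hS | ⟨x, hx, hxb⟩)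
    · exact hR.1 b.2 hS
    · exact hB.1 hb (Subtype.val_injective hxb ▸ hx)
  · obtain ⟨b, hb⟩ := hB.nonempty
    have hR'R : R' ⊆ R := hR.subset_of_connected (fun x hx hxS => hR' hx (Or.inl hxS)) hconn
      ⟨b, b.2, hsub ⟨b, hb, rfl⟩⟩
    have himage : Subtype.val '' (Subtype.val ⁻¹' R' : Set R) = R' := by
      rw [Subtype.image_preimage_coe, Set.inter_eq_right.2 hR'R]
    have hpre := hB.2.2 (Subtype.val ⁻¹' R') (fun x hx => hsub ⟨x, hx, rfl⟩)
      (fun x hx hxX => hR' hx (Or.inr ⟨x, hxX, rfl⟩))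
      ((induce_induce_connected_iff G R _).2 (himage.symm ▸ hconn))
    rw [← hpre, himage]

theorem numComp_add_numComp_induce_le [Finite V] {G : SimpleGraph V} {S R : Set V}
    (hR : IsCompOf G S R) (X : Set R) :
    numComp G S + numComp (G.induce R) X ≤ numComp G (S ∪ Subtype.val '' X) + 1 := by
  have hdisj : Disjoint ({A | IsCompOf G S A} \ {R})
      (Set.image Subtype.val '' {B | IsCompOf (G.induce R) X B}) := by
    rw [Set.disjoint_left]
    rintro _ ⟨hA, hne⟩ ⟨B, hB, rfl⟩
    obtain ⟨b, hb⟩ := hB.nonempty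
    exact hne (IsCompOf.eq_of_inter_nonempty hA hR ⟨b, ⟨b, hb, rfl⟩, b.2⟩)
  have hsub : ({A | IsCompOf G S A} \ {R}) ∪
      (Set.image Subtype.val '' {B | IsCompOf (G.induce R) X B}) ⊆
      {A | IsCompOf G (S ∪ Subtype.val '' X) A} := by
    rintro _ (⟨hA, hne⟩ | ⟨B, hB, rfl⟩)
    · exact IsCompOf.union_of_ne hA hR hne X
    · exact hR.image_val hB
  have hle := Set.ncard_le_ncard hsub (Set.toFinite _)
  rw [Set.ncard_union_eq hdisj (Set.toFinite _) (Set.toFinite _),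
    Set.ncard_image_of_injective _ Subtype.val_injective.image_injective] at hle
  have hone := Set.ncard_sdiff_singleton_add_one (a := R) (s := {A | IsCompOf G S A}) hR
    (Set.toFinite _)
  change _ + numComp (G.induce R) X ≤ numComp G _ at hle
  change _ + 1 = numComp G S at hone
  omega

theorem numComp_empty_le_one {G : SimpleGraph V} (hG : G.Connected) : numComp G ∅ ≤ 1 := by
  have hsub : {A | IsCompOf G ∅ A} ⊆ {Set.univ} := fun A hA =>
    (hA.2.2 Set.univ (Set.subset_univ A) (by simp)
      ((SimpleGraph.induceUnivIso G).connected_iff.2 hG)).symm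
  simpa [numComp] using Set.ncard_le_ncard hsub (Set.toFinite _)

/-- If `τ(G) = t ≤ 1`, `S` is a maximal tough-set of `G`, `R` is a
component of `G - S`, `k ≥ 1` and `t ≥ 1/k`, then `R` is `1/k`-tough. -/
theorem stmt_15 {V : Type*} [Fintype V] (G : SimpleGraph V) (t : ℝ)
    (hconn : G.Connected) (htough : IsToughness G t) (ht : t ≤ 1)
    (S : Set V) (hS : ToughSet G t S)
    (hmax : ∀ S' : Set V, ToughSet G t S' → S ⊆ S' → S' = S)
    (R : Set V) (hR : IsCompOf G S R) (k : ℕ) (hk : 1 ≤ k) (htk : 1 / (k : ℝ) ≤ t) :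
    Tough (1 / (k : ℝ)) (G.induce R) := by
  intro X hX
  have hk0 : (0 : ℝ) < k := by exact_mod_cast hk
  have ht0 : 0 < t := lt_of_lt_of_le (by positivity) htk
  have hcut : 2 ≤ numComp (G.induce R) X := hX
  have hS2 : 2 ≤ numComp G S := hS.1
  have hcount := numComp_add_numComp_induce_le hR X
  have hcutUnion : IsCutset G (S ∪ Subtype.val '' X) := by
    unfold IsCutset
    omega
  have hXne : X.Nonempty := by
    rw [Set.nonempty_iff_ne_empty]
    rintro rfl
    have := numComp_empty_le_one hR.2.1
    omega
  have hcard : (S ∪ Subtype.val '' X).ncard = S.ncard + X.ncard := by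
    rw [Set.ncard_union_eq _ (Set.toFinite _) (Set.toFinite _),
      Set.ncard_image_of_injective _ Subtype.val_injective]
    rw [Set.disjoint_left]
    rintro _ hxS ⟨x, -, rfl⟩
    exact hR.1 x.2 hxS
  have hne : ((S ∪ Subtype.val '' X).ncard : ℝ) ≠
      t * (numComp G (S ∪ Subtype.val '' X) : ℝ) := fun heq => by
    have hunion := hmax _ ⟨hcutUnion, heq⟩ Set.subset_union_left
    obtain ⟨x, hx⟩ := hXne
    exact hR.1 x.2 (hunion ▸ Or.inr ⟨x, hx, rfl⟩)
  have hlt := lt_of_le_of_ne (htough.1 _ hcutUnion) hne.symm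
  rw [hcard, Nat.cast_add, hS.2] at hlt
  have hcount' : (numComp G S : ℝ) + numComp (G.induce R) X ≤
      numComp G (S ∪ Subtype.val '' X) + 1 := by exact_mod_cast hcount
  have hX_lt : t * ((numComp (G.induce R) X : ℝ) - 1) < X.ncard := by nlinarith
  have hcut' : (2 : ℝ) ≤ numComp (G.induce R) X := by exact_mod_cast hcut
  have hX_lt' : 1 / (k : ℝ) * ((numComp (G.induce R) X : ℝ) - 1) < X.ncard :=
    lt_of_le_of_lt (mul_le_mul_of_nonneg_right htk (by linarith)) hX_lt
  rw [one_div_mul_eq_div, div_lt_iff₀ hk0] at hX_lt'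
  have hnat : numComp (G.induce R) X < X.ncard * k + 1 := by
    have : (numComp (G.induce R) X : ℝ) < X.ncard * k + 1 := by linarith
    exact_mod_cast this
  rw [one_div_mul_eq_div, div_le_iff₀ hk0]
  exact_mod_cast Nat.lt_succ_iff.1 hnat
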